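/- arXiv:1405.4661 — 3 statements merged into one kernel-verified Lean document; each statement's English description precedes it below -/
import Mathlib

section
/- Let n > 10 be an integer, p > p_c and α > 0. Suppose v₀ : [0,∞) → ℝ is continuous, nonnegative, and satisfies v₀(r) ≤ φ_α(r) − b(r+1)^{−γ} for all r ≥ 0, with some b > 0 and γ ∈ (ν+λ₁, (n−2)/2). Then there exists c > 0 such that every bounded classical radial solution v of (v^p)_t = v_rr + ((n−1)/r)v_r + v^p with initial data v₀ satisfies φ_α(0) − v(0,t) ≥ c e^{−κ(γ) t} for all t ≥ 0, where κ(γ) := γ(n−2−γ)/(pL^{p−1}) − 1. -/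
noncomputable section

open Real Filter Set Asymptotics

/-- `ν = 2/(p-1)`. -/
def nuExp (p : ℝ) : ℝ := 2 / (p - 1)

/-- `L = (ν(n−2−ν))^{1/(p−1)}`. -/
def Lconst (n : ℕ) (p : ℝ) : ℝ := (nuExp p * ((n : ℝ) - 2 - nuExp p)) ^ (1 / (p - 1))

/-- The critical exponent `p_c` for `n > 10`. -/
def pc (n : ℕ) : ℝ :=
  (((n : ℝ) - 2) ^ 2 - 4 * (n : ℝ) + 8 * Real.sqrt ((n : ℝ) - 1)) /
    (((n : ℝ) - 2) * ((n : ℝ) - 10))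

/-- `λ₁ = (n−2−2ν − √((n−2−2ν)² − 8(n−2−ν)))/2`. -/
def lam1 (n : ℕ) (p : ℝ) : ℝ :=
  (((n : ℝ) - 2 - 2 * nuExp p) -
    Real.sqrt (((n : ℝ) - 2 - 2 * nuExp p) ^ 2 - 8 * ((n : ℝ) - 2 - nuExp p))) / 2

/-- `κ(γ) = γ(n−2−γ)/(pL^{p−1}) − 1`. -/
def kappaOf (n : ℕ) (p γ : ℝ) : ℝ :=
  γ * ((n : ℝ) - 2 - γ) / (p * Lconst n p ^ (p - 1)) - 1

/-- `φ` is the (radial profile of the) positive steady state `φ_α` of `Δφ + φ^p = 0`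
with `φ(0) = α`, `φ'(0) = 0`, together with its properties in the supercritical range
`n > 10`, `p > p_c`: positivity, strict monotonicity, the bound `φ(r) ≤ L r^{−ν}`, and the
asymptotic expansion `φ(r) = L r^{−ν} − a r^{−ν−λ₁} + o(r^{−ν−λ₁})` with coefficient `a > 0`. -/
structure IsSteadyStateA (n : ℕ) (p α : ℝ) (φ : ℝ → ℝ) (a : ℝ) : Prop where
  cont : ContinuousOn φ (Set.Ici 0)
  smooth : ContDiffOn ℝ 2 φ (Set.Ioi 0)
  ode : ∀ r > (0 : ℝ), deriv (deriv φ) r + ((n : ℝ) - 1) / r * deriv φ r + φ r ^ p = 0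
  val0 : φ 0 = α
  deriv0 : derivWithin φ (Set.Ici 0) 0 = 0
  pos : ∀ r ≥ (0 : ℝ), 0 < φ r
  anti : StrictAntiOn φ (Set.Ici 0)
  upper : ∀ r > (0 : ℝ), φ r ≤ Lconst n p * r ^ (-nuExp p)
  a_pos : 0 < a
  expansion :
    (fun r => φ r - (Lconst n p * r ^ (-nuExp p) - a * r ^ (-nuExp p - lam1 n p)))
      =o[atTop] fun r => r ^ (-nuExp p - lam1 n p)

/-- `v` is a bounded classical radial solution of
`(v^p)_t = v_rr + ((n−1)/r) v_r + v^p` with initial data `v₀ : [0,∞) → ℝ`: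
nonnegative and continuous on `[0,∞) × [0,∞)`, bounded on `[0,∞) × [0,T]` for every
`T > 0`, `C²` in `r` and `C¹` in `t` for `t > 0` with `∂_r v(0,t) = 0`, satisfying the
equation pointwise for `r > 0`, `t > 0`, and attaining the initial data. -/
structure IsRadialSol (n : ℕ) (p : ℝ) (v : ℝ → ℝ → ℝ) (v₀ : ℝ → ℝ) : Prop where
  nonneg : ∀ r ≥ (0 : ℝ), ∀ t ≥ (0 : ℝ), 0 ≤ v r t
  cont : ContinuousOn (fun q : ℝ × ℝ => v q.1 q.2) (Set.Ici 0 ×ˢ Set.Ici 0)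
  bdd : ∀ T > (0 : ℝ), ∃ M, ∀ r ≥ (0 : ℝ), ∀ t ∈ Set.Icc (0 : ℝ) T, v r t ≤ M
  smooth_r : ∀ t > (0 : ℝ), ContDiffOn ℝ 2 (fun r => v r t) (Set.Ici 0)
  smooth_t : ∀ r ≥ (0 : ℝ), ContDiffOn ℝ 1 (fun s => v r s ^ p) (Set.Ioi (0 : ℝ))
  slope0 : ∀ t > (0 : ℝ), derivWithin (fun r => v r t) (Set.Ici 0) 0 = 0
  pde : ∀ r > (0 : ℝ), ∀ t > (0 : ℝ),
    deriv (fun s => v r s ^ p) t =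
      deriv (deriv fun ρ => v ρ t) r + ((n : ℝ) - 1) / r * deriv (fun ρ => v ρ t) r
        + v r t ^ p
  init : ∀ r ≥ (0 : ℝ), v r 0 = v₀ r

lemma aux_first_touch (f : ℝ → ℝ → ℝ) (R T ρ₁ ρ₂ : ℝ)
    (hcont : ContinuousOn (fun q : ℝ × ℝ => f q.1 q.2) (Ioo 0 R ×ˢ Ici 0))
    (hρ₁ : 0 < ρ₁) (hρ₂ : ρ₂ < R)
    (hbd : ∀ r ∈ Ioo 0 R, ∀ t ∈ Icc 0 T, (r < ρ₁ ∨ ρ₂ < r) → 0 < f r t)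
    (h0 : ∀ r ∈ Ioo 0 R, 0 < f r 0)
    (hno : ∀ r₀ ∈ Ioo 0 R, ∀ t₀ ∈ Ioc 0 T, f r₀ t₀ = 0 → (∀ r ∈ Ioo 0 R, 0 ≤ f r t₀) →
      (∀ t ∈ Ico 0 t₀, 0 < f r₀ t) → False) :
    ∀ r ∈ Ioo 0 R, ∀ t ∈ Icc 0 T, 0 < f r t := by
  by_contra hcon
  push Not at hcon
  obtain ⟨r1, hr1, t1, ht1, hf1⟩ := hcon
  have hsub : Icc ρ₁ ρ₂ ×ˢ Icc 0 T ⊆ Ioo 0 R ×ˢ Ici (0:ℝ) := by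
    rintro ⟨r, t⟩ ⟨hr, ht⟩
    exact ⟨⟨by have := hr.1; simp only at this; linarith, by have := hr.2; simp only at this; linarith⟩, ht.1⟩
  set S : Set (ℝ × ℝ) := (Icc ρ₁ ρ₂ ×ˢ Icc 0 T) ∩ (fun q : ℝ × ℝ => f q.1 q.2) ⁻¹' Iic 0 with hS
  have hK : IsCompact (Icc ρ₁ ρ₂ ×ˢ Icc (0:ℝ) T) := isCompact_Icc.prod isCompact_Icc
  have hScl : IsClosed S := (hcont.mono hsub).preimage_isClosed_of_isClosed hK.isClosed isClosed_Iic
  have hSc : IsCompact S := hK.of_isClosed_subset hScl inter_subset_left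
  have hmem : ∀ r ∈ Ioo 0 R, ∀ t ∈ Icc 0 T, f r t ≤ 0 → (r, t) ∈ S := by
    intro r hr t ht hf
    refine ⟨⟨⟨?_, ?_⟩, ht⟩, hf⟩
    · by_contra h
      exact absurd (hbd r hr t ht (Or.inl (not_le.mp h))) (not_lt.mpr hf)
    · by_contra h
      exact absurd (hbd r hr t ht (Or.inr (not_le.mp h))) (not_lt.mpr hf)
  obtain ⟨⟨r0, t0⟩, hx, hmin⟩ := hSc.exists_isMinOn ⟨_, hmem r1 hr1 t1 ht1 hf1⟩
    (continuous_snd.continuousOn (s := S))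
  have hrt := hsub hx.1
  have ht0 : t0 ∈ Icc 0 T := hx.1.2
  have hr0 : r0 ∈ Ioo 0 R := hrt.1
  have hf0 : f r0 t0 ≤ 0 := hx.2
  have hbefore : ∀ r ∈ Ioo 0 R, ∀ t ∈ Ico 0 t0, 0 < f r t := by
    intro r hr t ht
    by_contra h
    have := hmin (hmem r hr t ⟨ht.1, ht.2.le.trans ht0.2⟩ (not_lt.mp h))
    simp only [mem_ofPred_eq] at this
    exact absurd ht.2 (not_lt.mpr this)
  have ht0pos : 0 < t0 := by
    rcases ht0.1.lt_or_eq with h | h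
    · exact h
    · exfalso
      rw [← h] at hf0
      exact absurd (h0 r0 hr0) (not_lt.mpr hf0)
  have hge : ∀ r ∈ Ioo 0 R, 0 ≤ f r t0 := by
    intro r hr
    have hc : ContinuousWithinAt (fun t => f r t) (Ico 0 t0) t0 := by
      have h1 : ContinuousWithinAt (fun q : ℝ × ℝ => f q.1 q.2) (Ioo 0 R ×ˢ Ici 0) (r, t0) :=
        hcont _ ⟨hr, ht0.1⟩
      have h2 : ContinuousWithinAt (fun t : ℝ => ((r, t) : ℝ × ℝ)) (Ico 0 t0) t0 := by fun_prop
      exact ContinuousWithinAt.comp (f := fun t : ℝ => ((r, t) : ℝ × ℝ)) h1 h2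
        (fun t ht => ⟨hr, ht.1⟩)
    have hne : (nhdsWithin t0 (Ico 0 t0)).NeBot := by
      rw [nhdsWithin_Ico_eq_nhdsLT ht0pos]; infer_instance
    refine ge_of_tendsto hc ?_
    filter_upwards [self_mem_nhdsWithin] with t ht
    exact (hbefore r hr t ht).le
  exact hno r0 hr0 t0 ⟨ht0pos, ht0.2⟩ (le_antisymm hf0 (hge r0 hr0)) hge (hbefore r0 hr0)

lemma aux_space_touch (h h1 : ℝ → ℝ) (h2 r₀ : ℝ) (hmin : IsLocalMin h r₀)
    (hd : ∀ᶠ r in nhds r₀, HasDerivAt h (h1 r) r) (hd2 : HasDerivAt h1 h2 r₀) :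
    h1 r₀ = 0 ∧ 0 ≤ h2 := by
  have e1 : h1 r₀ = 0 := hmin.hasDerivAt_eq_zero hd.self_of_nhds
  refine ⟨e1, ?_⟩
  by_contra hneg
  push Not at hneg
  have hder : deriv h =ᶠ[nhds r₀] h1 := hd.mono (fun r hr => hr.deriv)
  have hdd : deriv (deriv h) r₀ = h2 := by
    rw [hder.deriv_eq]; exact hd2.deriv
  have hmax : IsLocalMax h r₀ := by
    apply isLocalMax_of_deriv_deriv_neg
    · rw [hdd]; exact hneg
    · rw [hder.self_of_nhds]; exact e1
    · exact hd.self_of_nhds.continuousAt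
  have hconst : h =ᶠ[nhds r₀] fun _ => h r₀ := by
    filter_upwards [hmin, hmax] with r a b
    exact le_antisymm b a
  have : deriv (deriv h) r₀ = 0 := by
    rw [hconst.deriv.deriv_eq]; simp
  rw [hdd] at this
  linarith

lemma aux_time_touch (u : ℝ → ℝ) (u' t₀ : ℝ) (ht : 0 < t₀) (hu : HasDerivAt u u' t₀)
    (h0 : u t₀ = 0) (hpos : ∀ t ∈ Ico 0 t₀, 0 < u t) : u' ≤ 0 := by
  have h := (hu.hasDerivWithinAt (s := Iio t₀))
  rw [hasDerivWithinAt_iff_tendsto_slope' (by simp)] at h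
  refine le_of_tendsto h ?_
  filter_upwards [Ico_mem_nhdsLT ht] with t htt
  rw [slope_def_field, h0]
  apply div_nonpos_of_nonneg_of_nonpos
  · have := hpos t htt; linarith
  · linarith [htt.2]

lemma aux_tangent (p x y : ℝ) (hp : 1 < p) (hx : 0 < x) (hy : 0 < y) :
    y ^ p + p * y ^ (p - 1) * (x - y) ≤ x ^ p := by
  have hb := one_add_mul_self_le_rpow_one_add (s := x / y - 1) (p := p)
    (by have : 0 < x / y := by positivity
        linarith) hp.le
  have e : (1 + (x / y - 1)) = x / y := by ring
  rw [e, Real.div_rpow hx.le hy.le, le_div_iff₀ (by positivity)] at hb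
  have e2 : y ^ p = y ^ (p - 1) * y := by
    rw [← Real.rpow_add_one hy.ne']; ring_nf
  calc _ = (1 + p * (x / y - 1)) * y ^ p := by
        rw [e2]; field_simp
    _ ≤ _ := hb

/-- supersolution inequality for `w = φ - g ψ` -/
lemma aux_super (p K0 k C g ph ps : ℝ) (hp : 1 < p) (hK0 : 0 < K0) (hk : 0 < k)
    (hC : C = 2 * p * K0 * (k + 1)) (hg : 0 < g) (hg2 : 2 * p * K0 * g ≤ 1)
    (hph : 0 < ph) (hps : 0 ≤ ps) (hle : ps ≤ K0 * ph) :
    0 < ph - g * ps ∧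
    -ph ^ p + (k + 1) * p * ph ^ (p - 1) * (g * ps) + (ph - g * ps) ^ p
      ≤ p * (ph - g * ps) ^ (p - 1) * ((k * g + C * g ^ 2) * ps) := by
  have h1 : g * ps ≤ (K0 * g) * ph := by nlinarith
  have hKg : K0 * g ≤ 1 / (2 * p) := by
    rw [le_div_iff₀ (by positivity)]; linarith
  have hKg2 : K0 * g < 1 := by
    have : 1 / (2 * p) < 1 := by rw [div_lt_one (by positivity)]; linarith
    linarith
  have hKgpos : 0 < K0 * g := by positivity
  have hw : (1 - K0 * g) * ph ≤ ph - g * ps := by linarith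
  have hw0 : 0 < ph - g * ps := lt_of_lt_of_le (mul_pos (by linarith) hph) hw
  refine ⟨hw0, ?_⟩
  set w := ph - g * ps with hwdef
  have ht := aux_tangent p ph w hp hph hw0
  have e1 : ph - w = g * ps := by rw [hwdef]; ring
  rw [e1] at ht
  -- key
  have hb : 1 - p * (K0 * g) ≤ (1 - K0 * g) ^ (p - 1) := by
    have hb1 := one_add_mul_self_le_rpow_one_add (s := -(K0 * g)) (p := p) (by linarith) hp.le
    have hb2 : (1 - K0 * g) ^ p ≤ (1 - K0 * g) ^ (p - 1) :=
      Real.rpow_le_rpow_of_exponent_ge (by linarith) (by linarith) (by linarith)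
    have : (1 + -(K0 * g)) = 1 - K0 * g := by ring
    rw [this] at hb1
    linarith
  have hwp : (1 - p * (K0 * g)) * ph ^ (p - 1) ≤ w ^ (p - 1) := by
    calc _ ≤ (1 - K0 * g) ^ (p - 1) * ph ^ (p - 1) := by
          apply mul_le_mul_of_nonneg_right hb; positivity
      _ = ((1 - K0 * g) * ph) ^ (p - 1) := by
          rw [Real.mul_rpow (by linarith) hph.le]
      _ ≤ _ := Real.rpow_le_rpow (mul_nonneg (by linarith) hph.le) hw (by linarith)
  have hCpos : 0 < C := by rw [hC]; positivity
  have hnum : k + 1 ≤ (1 - p * (K0 * g)) * (k + 1 + C * g) := by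
    have : (1 - p * (K0 * g)) * (k + 1 + C * g) - (k + 1) = p * K0 * g * (k+1) * (1 - 2 * p * K0 * g) := by
      rw [hC]; ring
    have h3 : 0 ≤ p * K0 * g * (k+1) * (1 - 2 * p * K0 * g) :=
      mul_nonneg (by positivity) (by linarith)
    linarith
  have hkey : (k + 1) * ph ^ (p - 1) ≤ w ^ (p - 1) * (k + 1 + C * g) := by
    have hpp : 0 < ph ^ (p - 1) := by positivity
    calc _ ≤ ((1 - p * (K0 * g)) * (k + 1 + C * g)) * ph ^ (p - 1) :=
          mul_le_mul_of_nonneg_right hnum hpp.le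
      _ = ((1 - p * (K0 * g)) * ph ^ (p - 1)) * (k + 1 + C * g) := by ring
      _ ≤ _ := mul_le_mul_of_nonneg_right hwp (by positivity)
  have hgp : 0 ≤ p * (g * ps) := by positivity
  have := mul_le_mul_of_nonneg_left hkey hgp
  nlinarith

/-- adding the barrier -/
lemma aux_add_barrier (p w wt lap z lz : ℝ) (hp : 1 < p) (hw : 0 < w) (hwt : 0 ≤ wt)
    (hz : 0 < z) (h : lap + w ^ p ≤ p * w ^ (p - 1) * wt) (hlz : lz ≤ z ^ p) :
    lap + lz + (w + z) ^ p < p * (w + z) ^ (p - 1) * (wt + 2 * z) := by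
  have ht := aux_tangent p w (w + z) hp hw (by linarith)
  have h1 : p * w ^ (p - 1) * wt ≤ p * (w + z) ^ (p - 1) * wt := by
    have : w ^ (p - 1) ≤ (w + z) ^ (p - 1) := Real.rpow_le_rpow hw.le (by linarith) (by linarith)
    gcongr
  have h2 : z ^ p < p * (w + z) ^ (p - 1) * z := by
    have e2 : z ^ p = z ^ (p - 1) * z := by
      rw [← Real.rpow_add_one hz.ne']; ring_nf
    have : z ^ (p - 1) ≤ (w + z) ^ (p - 1) := Real.rpow_le_rpow hz.le (by linarith) (by linarith)
    have h3 : 0 < z ^ (p-1) := by positivity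
    rw [e2]
    have : z ^ (p-1) < p * (w + z) ^ (p - 1) := by nlinarith
    exact mul_lt_mul_of_pos_right this hz
  nlinarith

lemma aux_pow_deriv (s r : ℝ) (hr : 0 < r) :
    HasDerivAt (fun x : ℝ => x ^ s) (s * r ^ (s - 1)) r :=
  Real.hasDerivAt_rpow_const (Or.inl hr.ne')

lemma aux_psi (N γ μ R0 C1 : ℝ) (Q : ℝ → ℝ) (hμ : 0 < μ) (hγ : 0 < γ)
    (hN : 2 * γ + μ < N - 2) (hR0 : 1 ≤ R0) (hC1 : 0 ≤ C1)
    (hQ0 : ∀ r > 0, 0 ≤ Q r)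
    (hQ : ∀ r ≥ R0, γ * (N - 2 - γ) * (r⁻¹ ^ 2 * (1 - C1 * r ^ (-μ))) ≤ Q r) :
    ∃ ψ : ℝ → ℝ, Continuous ψ ∧ (∀ r, 0 < ψ r) ∧
      (∀ r ≥ 0, ψ r ≤ 2 ^ γ * (r + 1) ^ (-γ)) ∧
      ∀ r₀ > 0, ∃ F F1 : ℝ → ℝ, ∃ F2 : ℝ,
        (∀ᶠ r in nhds r₀, HasDerivAt F (F1 r) r ∧ F r ≤ ψ r) ∧ F r₀ = ψ r₀ ∧
        HasDerivAt F1 F2 r₀ ∧ 0 ≤ F2 + (N - 1) / r₀ * F1 r₀ + Q r₀ * ψ r₀ := by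
  obtain ⟨d, hd, hdpos⟩ : ∃ d, d = μ * (N - 2 - 2 * γ - μ) ∧ 0 < d :=
    ⟨_, rfl, mul_pos hμ (by linarith)⟩
  have hPpos : 0 < γ * (N - 2 - γ) := mul_pos hγ (by linarith)
  obtain ⟨B, hB0, hB1, hB2⟩ : ∃ B : ℝ, 0 < B ∧ R0 ^ μ ≤ B ∧ C1 * (γ * (N - 2 - γ)) ≤ B * d := by
    refine ⟨max (R0 ^ μ) (C1 * (γ * (N - 2 - γ)) / d), ?_, le_max_left _ _, ?_⟩
    · exact lt_max_of_lt_left (by positivity)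
    · rw [← div_le_iff₀ hdpos]; exact le_max_right _ _
  set θ := γ / (γ + μ) with hθ
  have hθ0 : 0 < θ := by positivity
  have hθ1 : θ < 1 := by rw [hθ, div_lt_one (by positivity)]; linarith
  obtain ⟨Rm, hRm0, hRmμ⟩ : ∃ Rm : ℝ, 0 < Rm ∧ Rm ^ μ = B / θ := by
    refine ⟨(B / θ) ^ (1 / μ), by positivity, ?_⟩
    rw [← Real.rpow_mul (by positivity), one_div_mul_cancel hμ.ne', Real.rpow_one]
  have hRmR0 : R0 ≤ Rm := by
    rw [← Real.rpow_le_rpow_iff (by linarith) hRm0.le hμ, hRmμ]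
    refine hB1.trans ?_
    rw [le_div_iff₀ hθ0]; nlinarith
  have hRmneg : B * Rm ^ (-μ) = θ := by
    rw [Real.rpow_neg hRm0.le, hRmμ]; field_simp
  set F : ℝ → ℝ := fun r => r ^ (-γ) - B * r ^ (-γ - μ) with hF
  have hFfac : ∀ r > 0, F r = r ^ (-γ) * (1 - B * r ^ (-μ)) := by
    intro r hr
    simp only [hF]
    rw [show -γ - μ = -γ + -μ by ring, Real.rpow_add hr]; ring
  have hsmall : ∀ r ≥ Rm, B * r ^ (-μ) ≤ θ := by
    intro r hr
    rw [← hRmneg]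
    exact mul_le_mul_of_nonneg_left
      (Real.rpow_le_rpow_of_nonpos hRm0 hr (by linarith)) hB0.le
  have hFpos : ∀ r ≥ Rm, 0 < F r := by
    intro r hr
    have hr0 : 0 < r := by linarith
    rw [hFfac r hr0]
    have := hsmall r hr
    exact mul_pos (by positivity) (by linarith)
  have hFle : ∀ r > 0, F r ≤ r ^ (-γ) := by
    intro r hr
    simp only [hF]
    have : 0 < B * r ^ (-γ - μ) := by positivity
    linarith
  have hFmax : ∀ r > 0, F r ≤ F Rm := by
    intro r hr
    set y := Rm / r with hy
    have hy0 : 0 < y := by positivity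
    have hry : r = Rm * y⁻¹ := by rw [hy]; field_simp
    have e1 : r ^ (-γ) = Rm ^ (-γ) * y ^ γ := by
      rw [hry, Real.mul_rpow hRm0.le (by positivity), Real.inv_rpow hy0.le, Real.rpow_neg hy0.le,
        inv_inv]
    have e2 : r ^ (-μ) = Rm ^ (-μ) * y ^ μ := by
      rw [hry, Real.mul_rpow hRm0.le (by positivity), Real.inv_rpow hy0.le, Real.rpow_neg hy0.le,
        inv_inv]
    have ag := Real.geom_mean_le_arith_mean2_weighted (w₁ := 1 - θ) (w₂ := θ) (p₁ := 1)
      (p₂ := y ^ (γ + μ)) (by linarith) hθ0.le zero_le_one (by positivity) (by ring)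
    have e3 : (y ^ (γ + μ)) ^ θ = y ^ γ := by
      rw [← Real.rpow_mul hy0.le]; congr 1; rw [hθ]; field_simp
    rw [e3, Real.one_rpow, one_mul, Real.rpow_add hy0] at ag
    rw [hFfac r hr, hFfac Rm hRm0, e1, e2, hRmneg, ← mul_assoc B, hRmneg]
    have hp : 0 < Rm ^ (-γ) := by positivity
    nlinarith
  have hm0 : ∀ r, Rm ≤ max r Rm := fun r => le_max_right _ _
  refine ⟨fun r => F (max r Rm), ?_, fun r => hFpos _ (hm0 r), ?_, ?_⟩
  · have hc : ContinuousOn F (Ioi 0) := by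
      intro x hx
      apply ContinuousAt.continuousWithinAt
      have hx0 : x ≠ 0 := ne_of_gt hx
      simp only [hF]
      exact (Real.continuousAt_rpow_const _ _ (Or.inl hx0)).sub
        (continuousAt_const.mul (Real.continuousAt_rpow_const _ _ (Or.inl hx0)))
    exact hc.comp_continuous (by fun_prop) (fun r => lt_of_lt_of_le hRm0 (hm0 r))
  · intro r hr
    have h1 := hm0 r
    set m := max r Rm
    have hrm : r ≤ m := le_max_left _ _
    have hm1 : 1 ≤ m := by linarith
    refine (hFle m (by linarith)).trans ?_
    have e : (2:ℝ) ^ γ * (r + 1) ^ (-γ) = ((r + 1) / 2) ^ (-γ) := by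
      rw [Real.div_rpow (by linarith) (by norm_num), Real.rpow_neg (by norm_num : (0:ℝ) ≤ 2)]
      field_simp
    rw [e]
    exact Real.rpow_le_rpow_of_nonpos (by linarith) (by linarith) (by linarith)
  · intro r₀ hr₀
    rcases lt_or_ge r₀ Rm with hlt | hge
    · refine ⟨fun _ => F Rm, fun _ => 0, 0, ?_, ?_, hasDerivAt_const _ _, ?_⟩
      · filter_upwards [Iio_mem_nhds hlt] with r hr
        exact ⟨hasDerivAt_const _ _, by rw [max_eq_right (le_of_lt hr)]⟩
      · simp only; rw [max_eq_right hlt.le]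
      · have := mul_nonneg (hQ0 r₀ hr₀) (hFpos (max r₀ Rm) (hm0 _)).le
        simpa using this
    · refine ⟨F, fun r => (-γ) * r ^ (-γ - 1) - B * ((-γ - μ) * r ^ (-γ - μ - 1)),
        (-γ) * ((-γ - 1) * r₀ ^ (-γ - 1 - 1)) -
          B * ((-γ - μ) * ((-γ - μ - 1) * r₀ ^ (-γ - μ - 1 - 1))), ?_, ?_, ?_, ?_⟩
      · filter_upwards [Ioi_mem_nhds hr₀] with r hr
        refine ⟨?_, ?_⟩
        · exact (aux_pow_deriv _ r hr).sub ((aux_pow_deriv _ r hr).const_mul B)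
        · rcases le_total r Rm with h | h
          · rw [max_eq_right h]; exact hFmax r hr
          · rw [max_eq_left h]
      · simp only; rw [max_eq_left hge]
      · exact ((aux_pow_deriv _ r₀ hr₀).const_mul (-γ)).sub
          (((aux_pow_deriv _ r₀ hr₀).const_mul (-γ - μ)).const_mul B)
      · simp only
        rw [max_eq_left hge, hFfac r₀ hr₀]
        have hq := hQ r₀ (hRmR0.trans hge)
        have hs := hsmall r₀ hge
        have g1 : r₀ ^ (-γ - 1) = r₀ ^ (-γ) * r₀⁻¹ := by
          rw [Real.rpow_sub_one hr₀.ne']; rfl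
        have g2 : r₀ ^ (-γ - 1 - 1) = r₀ ^ (-γ) * r₀⁻¹ ^ 2 := by
          rw [Real.rpow_sub_one hr₀.ne', g1, div_eq_mul_inv]; ring
        have g0 : r₀ ^ (-γ - μ) = r₀ ^ (-γ) * r₀ ^ (-μ) := by
          rw [← Real.rpow_add hr₀]; ring_nf
        have g3 : r₀ ^ (-γ - μ - 1) = r₀ ^ (-γ) * r₀ ^ (-μ) * r₀⁻¹ := by
          rw [Real.rpow_sub_one hr₀.ne', g0, div_eq_mul_inv]
        have g4 : r₀ ^ (-γ - μ - 1 - 1) = r₀ ^ (-γ) * r₀ ^ (-μ) * r₀⁻¹ ^ 2 := by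
          rw [Real.rpow_sub_one hr₀.ne', g3, div_eq_mul_inv]; ring
        rw [g1, g2, g3, g4, div_eq_mul_inv]
        have hu : 0 < r₀ ^ (-γ) := by positivity
        have hm : 0 < r₀ ^ (-μ) := by positivity
        have hi : 0 < r₀⁻¹ := by positivity
        set u := r₀ ^ (-γ)
        set m := r₀ ^ (-μ)
        set i := r₀⁻¹
        have hfac : 0 ≤ u * (1 - B * m) := mul_nonneg hu.le (by linarith)
        have h1 := mul_le_mul_of_nonneg_right hq hfac
        have h2 : 0 ≤ (u * i ^ 2 * m) * (B * d - C1 * (γ * (N - 2 - γ))) :=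
          mul_nonneg (by positivity) (by linarith)
        have h3 : 0 ≤ (u * i ^ 2 * m) * (C1 * (γ * (N - 2 - γ)) * (B * m)) := by positivity
        rw [hd] at h2
        nlinarith [h1, h2, h3]

lemma aux_barrier (N ν p : ℝ) (hN : 1 ≤ N) (hp : 1 < p) (hν : ν = 2 / (p - 1)) :
    ∃ A > 0, ∀ R > 0, ∀ X : ℝ → ℝ, X = (fun r => A * R ^ ν * (R ^ 2 - r ^ 2) ^ (-ν)) →
      ∃ X1 X2 : ℝ → ℝ, ∀ r ∈ Ioo 0 R, HasDerivAt X (X1 r) r ∧ HasDerivAt X1 (X2 r) r ∧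
        0 < X r ∧ X2 r + (N - 1) / r * X1 r ≤ X r ^ p := by
  have hν0 : 0 < ν := by rw [hν]; exact div_pos two_pos (by linarith)
  have hνp : ν * p = ν + 2 := by
    have : p - 1 ≠ 0 := by linarith
    rw [hν]; field_simp; ring
  obtain ⟨C, hC, hC0⟩ : ∃ C, C = 2 * N * ν + 4 * ν * (ν + 1) ∧ 0 < C := ⟨_, rfl, by positivity⟩
  have hA0 : 0 < C ^ (1 / (p - 1)) := by positivity
  have hAp : (C ^ (1 / (p - 1))) ^ p = C * C ^ (1 / (p - 1)) := by
    rw [← Real.rpow_mul hC0.le]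
    nth_rewrite 2 [← Real.rpow_one C]
    rw [← Real.rpow_add hC0]
    congr 1
    have : p - 1 ≠ 0 := by linarith
    field_simp; ring
  refine ⟨C ^ (1 / (p - 1)), hA0, ?_⟩
  set A := C ^ (1 / (p - 1))
  intro R hR X hX
  set c := A * R ^ ν with hc
  have hc0 : 0 < c := by positivity
  have hq : ∀ r : ℝ, HasDerivAt (fun r : ℝ => R ^ 2 - r ^ 2) (-(2 * r)) r := by
    intro r
    have := (hasDerivAt_pow 2 r).const_sub (R ^ 2)
    simpa using this
  refine ⟨fun r => 2 * c * ν * (r * (R ^ 2 - r ^ 2) ^ (-ν - 1)),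
    fun r => 2 * c * ν * (1 * (R ^ 2 - r ^ 2) ^ (-ν - 1) +
      r * (-(2 * r) * (-ν - 1) * (R ^ 2 - r ^ 2) ^ (-ν - 1 - 1))), ?_⟩
  intro r hr
  have hr0 : 0 < r := hr.1
  have hq0 : 0 < R ^ 2 - r ^ 2 := by nlinarith [hr.1, hr.2]
  have hpow : ∀ s : ℝ, HasDerivAt (fun r : ℝ => (R ^ 2 - r ^ 2) ^ s)
      (-(2 * r) * s * (R ^ 2 - r ^ 2) ^ (s - 1)) r :=
    fun s => (hq r).rpow_const (Or.inl hq0.ne')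
  refine ⟨?_, ?_, ?_, ?_⟩
  · rw [hX]
    have h := (hpow (-ν)).const_mul c
    have e : c * (-(2 * r) * -ν * (R ^ 2 - r ^ 2) ^ (-ν - 1)) =
        2 * c * ν * (r * (R ^ 2 - r ^ 2) ^ (-ν - 1)) := by ring
    rw [e] at h
    exact h
  · exact ((hasDerivAt_id' r).mul (hpow (-ν - 1))).const_mul (2 * c * ν)
  · rw [hX]; positivity
  · rw [hX]
    simp only
    set q := R ^ 2 - r ^ 2 with hqd
    have e1 : q ^ (-ν - 1) = q * q ^ (-ν - 1 - 1) := by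
      rw [Real.rpow_sub_one hq0.ne' (-ν - 1)]; field_simp
    have e2 : (c * q ^ (-ν)) ^ p = C * c * R ^ 2 * q ^ (-ν - 1 - 1) := by
      rw [Real.mul_rpow hc0.le (by positivity), ← Real.rpow_mul hq0.le, hc,
        Real.mul_rpow hA0.le (by positivity), ← Real.rpow_mul hR.le, hνp, hAp,
        Real.rpow_add hR, show -ν * p = -ν - 1 - 1 by linarith]
      rw [Real.rpow_two]; ring
    rw [e2, e1]
    have hqq : 0 < q ^ (-ν - 1 - 1) := by positivity
    set Y := q ^ (-ν - 1 - 1)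
    have e3 : 2 * c * ν * (1 * (q * Y) + r * (-(2 * r) * (-ν - 1) * Y)) +
        (N - 1) / r * (2 * c * ν * (r * (q * Y))) =
        (c * Y) * (2 * ν * N * q + 4 * ν * (ν + 1) * r ^ 2) := by
      field_simp; ring
    rw [e3, show C * c * R ^ 2 * Y = (c * Y) * (C * R ^ 2) by ring]
    apply mul_le_mul_of_nonneg_left _ (by positivity)
    rw [hC, hqd]
    have h1 : 0 ≤ 2 * ν * N * r ^ 2 := by positivity
    have h2 : 0 ≤ 4 * ν * (ν + 1) * (R ^ 2 - r ^ 2) := by positivity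
    nlinarith

lemma aux_params (n : ℕ) (hn : 10 < n) (p : ℝ) (hp : pc n < p) :
    1 < p ∧ 0 < nuExp p ∧ 0 < (n:ℝ) - 2 - nuExp p ∧ 0 < lam1 n p ∧
    (nuExp p + lam1 n p) * ((n:ℝ) - 2 - (nuExp p + lam1 n p)) =
      (nuExp p + 2) * ((n:ℝ) - 2 - nuExp p) := by
  have hn' : (11:ℝ) ≤ n := by exact_mod_cast hn
  set s := Real.sqrt ((n:ℝ) - 1) with hs
  have hs2 : s ^ 2 = n - 1 := Real.sq_sqrt (by linarith)
  have hs0 : 0 ≤ s := Real.sqrt_nonneg _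
  have hs3 : 3 < s := by nlinarith
  have hden : 0 < ((n:ℝ) - 2) * (n - 10) := mul_pos (by linarith) (by linarith)
  have hp' := hp
  rw [pc, ← hs, div_lt_iff₀ hden] at hp'
  have hnn : (n:ℝ) = s ^ 2 + 1 := by linarith
  have hp1 : 4 * (s + 3) * (s - 1) < (p - 1) * ((s - 1) * (s + 1) * ((s - 3) * (s + 3))) := by
    rw [hnn] at hp'
    nlinarith
  have hp2 : 4 < (p - 1) * ((s + 1) * (s - 3)) := by
    have hpos : 0 < (s + 3) * (s - 1) := mul_pos (by linarith) (by linarith)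
    have : 4 * ((s + 3) * (s - 1)) < ((p - 1) * ((s + 1) * (s - 3))) * ((s + 3) * (s - 1)) := by
      nlinarith
    exact lt_of_mul_lt_mul_right this hpos.le
  have hss : 0 < (s + 1) * (s - 3) := mul_pos (by linarith) (by linarith)
  have hp3 : 0 < p - 1 := by
    by_contra h
    push Not at h
    nlinarith
  set ν := nuExp p with hν
  have hν0 : 0 < ν := by rw [hν, nuExp]; positivity
  have hν1 : 2 * ν < (s + 1) * (s - 3) := by
    rw [hν, nuExp, ← mul_div_assoc, div_lt_iff₀ hp3]; linarith
  have hx : 2 + 2 * s < (n:ℝ) - 2 - 2 * ν := by rw [hnn]; nlinarith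
  have hnv : 0 < (n:ℝ) - 2 - ν := by linarith
  set x := (n:ℝ) - 2 - 2 * ν with hxd
  have hD : 0 ≤ x ^ 2 - 8 * ((n:ℝ) - 2 - ν) := by
    have e : 8 * ((n:ℝ) - 2 - ν) = 4 * x + 4 * (n - 2) := by rw [hxd]; ring
    rw [e, hnn]; nlinarith
  have hsq := Real.sq_sqrt hD
  have hsn := Real.sqrt_nonneg (x ^ 2 - 8 * ((n:ℝ) - 2 - ν))
  have hl : lam1 n p = (x - Real.sqrt (x ^ 2 - 8 * ((n:ℝ) - 2 - ν))) / 2 := rfl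
  set D := Real.sqrt (x ^ 2 - 8 * ((n:ℝ) - 2 - ν))
  refine ⟨by linarith, hν0, hnv, ?_, ?_⟩
  · rw [hl]; nlinarith
  · rw [hl]
    have : (n:ℝ) - 2 = x + 2 * ν := by rw [hxd]; ring
    rw [this] at hsq ⊢
    nlinarith

lemma aux_L (n : ℕ) (p : ℝ) (hp : 1 < p) (h1 : 0 < nuExp p) (h2 : 0 < (n:ℝ) - 2 - nuExp p) :
    0 < Lconst n p ∧ p * Lconst n p ^ (p - 1) = (nuExp p + 2) * ((n:ℝ) - 2 - nuExp p) := by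
  have h3 : p - 1 ≠ 0 := by linarith
  refine ⟨by rw [Lconst]; positivity, ?_⟩
  rw [Lconst, ← Real.rpow_mul (by positivity), one_div_mul_cancel h3, Real.rpow_one]
  have : p * nuExp p = nuExp p + 2 := by rw [nuExp]; field_simp; ring
  rw [← mul_assoc, this]

/-- lower bound of the potential at infinity -/
lemma aux_potential (n : ℕ) (p α a : ℝ) (φ : ℝ → ℝ) (hφ : IsSteadyStateA n p α φ a)
    (hp : 1 < p) (hL : 0 < Lconst n p) (hl : 0 < lam1 n p) :
    ∃ R0 ≥ (1:ℝ), ∀ r ≥ R0, Lconst n p ^ (p - 1) *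
      (r⁻¹ ^ 2 * (1 - (p * (2 * a / Lconst n p)) * r ^ (-lam1 n p))) ≤ φ r ^ (p - 1) := by
  have ha := hφ.a_pos
  set L := Lconst n p
  set l := lam1 n p
  set ν := nuExp p with hν
  have h1 := hφ.expansion.bound ha
  have h2 : ∀ᶠ r : ℝ in atTop, (2 * a / L) * r ^ (-l) ≤ 1 := by
    have := (tendsto_rpow_neg_atTop hl).const_mul (2 * a / L)
    rw [mul_zero] at this
    exact (this.eventually (gt_mem_nhds one_pos)).mono (fun r h => h.le)
  obtain ⟨R0, hR0⟩ := eventually_atTop.mp (h1.and h2)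
  refine ⟨max 1 R0, le_max_left _ _, ?_⟩
  intro r hr
  have hr1 : 1 ≤ r := (le_max_left _ _).trans hr
  have hr0 : 0 < r := by linarith
  obtain ⟨hb, hs⟩ := hR0 r ((le_max_right _ _).trans hr)
  have hpw : 0 < r ^ (-ν - l) := by positivity
  rw [Real.norm_eq_abs, Real.norm_eq_abs, abs_of_pos hpw] at hb
  have hb2 := (abs_le.mp hb).1
  have e : r ^ (-ν - l) = r ^ (-ν) * r ^ (-l) := by rw [← Real.rpow_add hr0]; ring_nf
  rw [e] at hb2
  have hlow : (L * r ^ (-ν)) * (1 - (2 * a / L) * r ^ (-l)) ≤ φ r := by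
    have : (L * r ^ (-ν)) * (1 - (2 * a / L) * r ^ (-l)) =
      L * r ^ (-ν) - 2 * a * (r ^ (-ν) * r ^ (-l)) := by field_simp
    rw [this]; linarith
  set y := (2 * a / L) * r ^ (-l) with hy
  have hy0 : 0 ≤ y := by positivity
  have hbern : 1 - p * y ≤ (1 - y) ^ (p - 1) := by
    have hb1 := one_add_mul_self_le_rpow_one_add (s := -y) (p := p) (by linarith) hp.le
    have e : (1 + -y) = 1 - y := by ring
    rw [e] at hb1
    rcases hs.lt_or_eq with h | h
    · have hb2 : (1 - y) ^ p ≤ (1 - y) ^ (p - 1) :=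
        Real.rpow_le_rpow_of_exponent_ge (by linarith) (by linarith) (by linarith)
      linarith
    · rw [h]
      have : (0:ℝ) ≤ (1 - 1) ^ (p - 1) := Real.rpow_nonneg (by norm_num) _
      linarith
  have hLr : (L * r ^ (-ν)) ^ (p - 1) = L ^ (p - 1) * r⁻¹ ^ 2 := by
    rw [Real.mul_rpow hL.le (by positivity), ← Real.rpow_mul hr0.le]
    have h3 : p - 1 ≠ 0 := by linarith
    have : -ν * (p - 1) = -2 := by rw [hν, nuExp]; field_simp
    rw [this, Real.rpow_neg hr0.le, Real.rpow_two, inv_pow]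
  calc _ = (L ^ (p - 1) * r⁻¹ ^ 2) * (1 - p * y) := by rw [hy]; ring
    _ ≤ (L ^ (p - 1) * r⁻¹ ^ 2) * (1 - y) ^ (p - 1) :=
        mul_le_mul_of_nonneg_left hbern (by positivity)
    _ = ((L * r ^ (-ν)) * (1 - y)) ^ (p - 1) := by
        rw [Real.mul_rpow (by positivity) (by linarith), hLr]
    _ ≤ _ := Real.rpow_le_rpow (mul_nonneg (by positivity) (by linarith)) hlow (by linarith)

/-- the amplitude function -/
lemma aux_g (k C ε : ℝ) (hk : 0 < k) (hC : 0 < C) (hε : 0 < ε) :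
    ∃ g : ℝ → ℝ, ∃ c > 0, (∀ t ≥ 0, HasDerivAt g (-(k * g t + C * g t ^ 2)) t) ∧
      (∀ t ≥ 0, 0 < g t ∧ g t ≤ ε ∧ c * Real.exp (-k * t) ≤ g t) := by
  obtain ⟨A, hA, hA0⟩ : ∃ A, A = 1 / ε + C / k ∧ 0 < A := ⟨_, rfl, by positivity⟩
  have hge : ∀ t ≥ (0:ℝ), 1 / ε ≤ A * Real.exp (k * t) - C / k := by
    intro t ht
    have : 1 ≤ Real.exp (k * t) := Real.one_le_exp (by positivity)
    nlinarith
  have he : 0 < 1 / ε := by positivity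
  refine ⟨fun t => (A * Real.exp (k * t) - C / k)⁻¹, 1 / A, by positivity, ?_, ?_⟩
  · intro t ht
    have h1 := hge t ht
    have hne : A * Real.exp (k * t) - C / k ≠ 0 := by linarith
    have hd : HasDerivAt (fun t : ℝ => A * Real.exp (k * t) - C / k)
        (A * (Real.exp (k * t) * k)) t := by
      have h2 : HasDerivAt (fun t : ℝ => k * t) k t := by
        simpa using (hasDerivAt_id' t).const_mul k
      exact (h2.exp.const_mul A).sub_const _
    have h3 := hd.inv hne
    have e : -(A * (Real.exp (k * t) * k)) / (A * Real.exp (k * t) - C / k) ^ 2 =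
        -(k * (A * Real.exp (k * t) - C / k)⁻¹ + C * (A * Real.exp (k * t) - C / k)⁻¹ ^ 2) := by
      set D := A * Real.exp (k * t) - C / k with hD
      have : A * (Real.exp (k * t) * k) = k * D + C := by rw [hD]; field_simp; ring
      rw [this]; field_simp
    rw [e] at h3
    exact h3
  · intro t ht
    simp only
    have h1 := hge t ht
    have h0 : 0 < A * Real.exp (k * t) - C / k := by linarith
    refine ⟨by positivity, ?_, ?_⟩
    · rw [inv_le_comm₀ (by linarith) hε]; simpa using h1
    · rw [neg_mul, Real.exp_neg, one_div, ← mul_inv]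
      apply inv_anti₀ (by linarith)
      have : 0 < C / k := by positivity
      linarith

set_option maxHeartbeats 1000000 in
/-- comparison on a ball with the barrier -/
lemma aux_compare (n : ℕ) (hn : 10 < n) (p α a k C K0 η A R : ℝ) (φ ψ g v₀ : ℝ → ℝ)
    (v : ℝ → ℝ → ℝ) (hp : 1 < p)
    (hφ : IsSteadyStateA n p α φ a) (hv : IsRadialSol n p v v₀)
    (hk : 0 < k) (hK0 : 0 < K0) (hC : C = 2 * p * K0 * (k + 1)) (hη : 0 < η)
    (hA : 0 < A) (hR : 0 < R) (hν : 0 < nuExp p)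
    (hψc : Continuous ψ) (hψ0 : ∀ r, 0 < ψ r) (hψle : ∀ r ≥ 0, ψ r ≤ K0 * φ r)
    (hψsub : ∀ r₀ > 0, ∃ F F1 : ℝ → ℝ, ∃ F2 : ℝ,
        (∀ᶠ r in nhds r₀, HasDerivAt F (F1 r) r ∧ F r ≤ ψ r) ∧ F r₀ = ψ r₀ ∧
        HasDerivAt F1 F2 r₀ ∧
        0 ≤ F2 + ((n:ℝ) - 1) / r₀ * F1 r₀ + ((k + 1) * p * φ r₀ ^ (p - 1)) * ψ r₀)
    (hgd : ∀ t ≥ 0, HasDerivAt g (-(k * g t + C * g t ^ 2)) t)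
    (hg0 : ∀ t ≥ 0, 0 < g t) (hg1 : ∀ t ≥ 0, 2 * p * K0 * g t ≤ 1)
    (hinit : ∀ r ≥ 0, v₀ r ≤ φ r - g 0 * ψ r)
    (X : ℝ → ℝ) (hX : X = (fun r => A * R ^ nuExp p * (R ^ 2 - r ^ 2) ^ (-nuExp p)))
    (X1 X2 : ℝ → ℝ)
    (hXd : ∀ r ∈ Ioo 0 R, HasDerivAt X (X1 r) r ∧ HasDerivAt X1 (X2 r) r ∧
        0 < X r ∧ X2 r + ((n:ℝ) - 1) / r * X1 r ≤ X r ^ p) :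
    ∀ r ∈ Ioo 0 R, ∀ t ≥ 0, v r t ≤ φ r - g t * ψ r + Real.exp (2 * t) * (η * r⁻¹ + X r) := by
  intro r hr t ht
  have hn' : (11:ℝ) ≤ n := by exact_mod_cast hn
  have hsup := fun (r : ℝ) (hr : 0 < r) (t : ℝ) (ht : 0 ≤ t) =>
    aux_super p K0 k C (g t) (φ r) (ψ r) hp hK0 hk hC (hg0 t ht) (hg1 t ht)
      (hφ.pos r hr.le) (hψ0 r).le (hψle r hr.le)
  have hgc : ContinuousOn g (Ici 0) := fun t ht => (hgd t ht).continuousAt.continuousWithinAt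
  have hXc : ContinuousOn X (Ioo 0 R) := fun r hr =>
    (hXd r hr).1.continuousAt.continuousWithinAt
  have hsubset : Ioo 0 R ×ˢ Ici (0:ℝ) ⊆ Ici 0 ×ˢ Ici 0 :=
    prod_mono (fun x hx => le_of_lt hx.1) subset_rfl
  -- bound on v
  obtain ⟨M, hM⟩ := hv.bdd (t + 1) (by linarith)
  have hM' : ∀ r ≥ 0, ∀ s ∈ Icc 0 t, v r s ≤ max M 1 := fun r hr s hs =>
    (hM r hr s ⟨hs.1, by linarith [hs.2]⟩).trans (le_max_left _ _)
  set M' := max M 1 with hM'd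
  have hM1 : 1 ≤ M' := le_max_right _ _
  -- near R
  obtain ⟨ρ₂, hρ₂, hρ₂X⟩ : ∃ ρ₂ < R, ∀ r ∈ Ioo 0 R, ρ₂ < r → M' < X r := by
    have hcq : ContinuousAt (fun r : ℝ => M' * (R ^ 2 - r ^ 2) ^ nuExp p) R := by
      apply ContinuousAt.mul continuousAt_const
      apply ContinuousAt.rpow_const (by fun_prop) (Or.inr hν.le)
    have hlt : M' * (R ^ 2 - R ^ 2) ^ nuExp p < A * R ^ nuExp p := by
      rw [sub_self, Real.zero_rpow hν.ne', mul_zero]; positivity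
    have hev := hcq.eventually (gt_mem_nhds hlt)
    obtain ⟨ε, hε, hball⟩ := Metric.eventually_nhds_iff.mp hev
    refine ⟨R - ε, by linarith, ?_⟩
    intro r hr hlt
    have h1 := hball (y := r) (by rw [Real.dist_eq, abs_lt]; constructor <;> linarith [hr.2])
    have hq0 : 0 < R ^ 2 - r ^ 2 := by nlinarith [hr.1, hr.2]
    rw [hX]
    simp only
    rw [Real.rpow_neg hq0.le, ← div_eq_mul_inv, lt_div_iff₀ (by positivity)]
    exact h1
  have hfinal := aux_first_touch
    (fun r t => φ r - g t * ψ r + Real.exp (2 * t) * (η * r⁻¹ + X r) - v r t) R t (η / M') ρ₂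
    ?_ (by positivity) hρ₂ ?_ ?_ ?_ r hr t ⟨ht, le_rfl⟩
  · linarith
  · -- continuity
    have c1 : ContinuousOn (fun q : ℝ × ℝ => φ q.1) (Ioo 0 R ×ˢ Ici 0) :=
      hφ.cont.comp continuousOn_fst (fun q hq => (hsubset hq).1)
    have c2 : ContinuousOn (fun q : ℝ × ℝ => g q.2) (Ioo 0 R ×ˢ Ici 0) :=
      hgc.comp continuousOn_snd (fun q hq => hq.2)
    have c3 : ContinuousOn (fun q : ℝ × ℝ => X q.1) (Ioo 0 R ×ˢ Ici 0) :=
      hXc.comp continuousOn_fst (fun q hq => hq.1)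
    have c4 : ContinuousOn (fun q : ℝ × ℝ => (q.1)⁻¹) (Ioo 0 R ×ˢ Ici 0) :=
      continuousOn_fst.inv₀ (fun q hq => ne_of_gt hq.1.1)
    have c5 := hv.cont.mono hsubset
    have c6 : ContinuousOn (fun q : ℝ × ℝ => ψ q.1) (Ioo 0 R ×ˢ Ici 0) := by fun_prop
    have c7 : ContinuousOn (fun q : ℝ × ℝ => Real.exp (2 * q.2)) (Ioo 0 R ×ˢ Ici 0) := by fun_prop
    exact ((c1.sub (c2.mul c6)).add (c7.mul ((c4.const_mul η).add c3))).sub c5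
  · -- boundary
    intro r hr s hs hor
    have hw := (hsup r hr.1 s hs.1).1
    have hvM := hM' r hr.1.le s hs
    have hXp := (hXd r hr).2.2.1
    have hexp : 1 ≤ Real.exp (2 * s) := Real.one_le_exp (by linarith [hs.1])
    have hηr : 0 < η * r⁻¹ := mul_pos hη (inv_pos.mpr hr.1)
    have hz : M' < η * r⁻¹ + X r := by
      rcases hor with h | h
      · have : M' < η * r⁻¹ := by
          rw [← div_eq_mul_inv, lt_div_iff₀ hr.1]
          rw [lt_div_iff₀ (by linarith)] at h
          linarith
        linarith
      · have := hρ₂X r hr h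
        linarith
    nlinarith
  · -- initial
    intro r hr
    have h1 := hinit r hr.1.le
    rw [← hv.init r hr.1.le] at h1
    have hXp := (hXd r hr).2.2.1
    have hηr : 0 < η * r⁻¹ := mul_pos hη (inv_pos.mpr hr.1)
    simp only [mul_zero, Real.exp_zero]
    linarith
  · -- touching
    intro r₀ hr₀ t₀ ht₀ hzero hge hbefore
    have hr0 : 0 < r₀ := hr₀.1
    have ht0 : 0 < t₀ := ht₀.1
    obtain ⟨F, F1, F2, hF, hF0, hF2, hFsub⟩ := hψsub r₀ hr0
    obtain ⟨hw0, hwsup⟩ := hsup r₀ hr0 t₀ ht0.le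
    obtain ⟨_, hX2, hXp, hXsub⟩ := hXd r₀ hr₀
    have hg := hg0 t₀ ht0.le
    set E := Real.exp (2 * t₀) with hE
    have hE1 : 1 ≤ E := Real.one_le_exp (by linarith)
    -- space
    have hvd : ∀ r > 0, ContDiffAt ℝ 2 (fun ρ => v ρ t₀) r := fun r hr =>
      (hv.smooth_r t₀ ht0).contDiffAt (Ici_mem_nhds hr)
    have hφd : ∀ r > 0, ContDiffAt ℝ 2 φ r := fun r hr =>
      hφ.smooth.contDiffAt (Ioi_mem_nhds hr)
    have d1 : ∀ (u : ℝ → ℝ) (r : ℝ), ContDiffAt ℝ 2 u r → HasDerivAt u (deriv u r) r :=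
      fun u r hu => (hu.differentiableAt (by norm_num)).hasDerivAt
    have d2 : ∀ (u : ℝ → ℝ) (r : ℝ), ContDiffAt ℝ 2 u r →
        HasDerivAt (deriv u) (deriv (deriv u) r) r := by
      intro u r hu
      have h : ContDiffAt ℝ 1 (deriv u) r := hu.derivWithin (by norm_num)
      exact (h.differentiableAt (by norm_num)).hasDerivAt
    have hmin : IsLocalMin (fun r => φ r - g t₀ * F r + E * (η * r⁻¹ + X r) - v r t₀) r₀ := by
      filter_upwards [hF, Ioo_mem_nhds hr₀.1 hr₀.2] with r hFr hrr
      have h1 := hge r hrr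
      have h2 := mul_le_mul_of_nonneg_left hFr.2 hg.le
      rw [hF0]
      linarith
    obtain ⟨s1, s2⟩ := aux_space_touch _
      (fun r => deriv φ r - g t₀ * F1 r + E * (η * (-(r ^ 2)⁻¹) + X1 r) - deriv (fun ρ => v ρ t₀) r)
      (deriv (deriv φ) r₀ - g t₀ * F2 + E * (η * (-(-(2 * r₀) / (r₀ ^ 2) ^ 2)) + X2 r₀) -
        deriv (deriv fun ρ => v ρ t₀) r₀) r₀ hmin
      (by
        filter_upwards [hF, Ioo_mem_nhds hr₀.1 hr₀.2] with r hFr hrr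
        exact (((d1 _ r (hφd r hrr.1)).sub (hFr.1.const_mul _)).add
          ((((hasDerivAt_inv (ne_of_gt hrr.1)).const_mul η).add (hXd r hrr).1).const_mul E)).sub
          (d1 _ r (hvd r hrr.1)))
      (by
        have hi : HasDerivAt (fun r : ℝ => (r ^ 2)⁻¹) (-(2 * r₀) / (r₀ ^ 2) ^ 2) r₀ := by
          have h := (hasDerivAt_pow 2 r₀).inv (pow_ne_zero 2 hr0.ne')
          have e : -((2:ℕ) * r₀ ^ (2 - 1)) / (r₀ ^ 2) ^ 2 = -(2 * r₀) / (r₀ ^ 2) ^ 2 := by norm_num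
          rw [e] at h
          exact h
        exact (((d2 _ r₀ (hφd r₀ hr0)).sub (hF2.const_mul _)).add
          (((hi.neg.const_mul η).add hX2).const_mul E)).sub (d2 _ r₀ (hvd r₀ hr0)))
    -- time
    set W := φ r₀ - g t₀ * ψ r₀ + E * (η * r₀⁻¹ + X r₀) with hW
    have hz0 : 0 < E * (η * r₀⁻¹ + X r₀) := by positivity
    have hvW : v r₀ t₀ = W := by linarith
    have hW0 : 0 < W := by linarith
    have hWt : HasDerivAt (fun s => φ r₀ - g s * ψ r₀ + Real.exp (2 * s) * (η * r₀⁻¹ + X r₀))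
        ((k * g t₀ + C * g t₀ ^ 2) * ψ r₀ + 2 * (E * (η * r₀⁻¹ + X r₀))) t₀ := by
      have h2 : HasDerivAt (fun t : ℝ => 2 * t) 2 t₀ := by
        simpa using (hasDerivAt_id' t₀).const_mul (2:ℝ)
      have h := (((hgd t₀ ht0.le).mul_const (ψ r₀)).const_sub (φ r₀)).add
        (h2.exp.mul_const (η * r₀⁻¹ + X r₀))
      have e : -(-(k * g t₀ + C * g t₀ ^ 2) * ψ r₀) +
          Real.exp (2 * t₀) * 2 * (η * r₀⁻¹ + X r₀) =
          (k * g t₀ + C * g t₀ ^ 2) * ψ r₀ + 2 * (E * (η * r₀⁻¹ + X r₀)) := by rw [hE]; ring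
      rw [e] at h
      exact h
    have hWp := hWt.rpow_const (p := p) (Or.inr hp.le)
    have hvt : HasDerivAt (fun s => v r₀ s ^ p) (deriv (fun s => v r₀ s ^ p) t₀) t₀ :=
      (((hv.smooth_t r₀ hr0.le).contDiffAt (Ioi_mem_nhds ht0)).differentiableAt
        (by norm_num)).hasDerivAt
    have htt := aux_time_touch _ _ t₀ ht0 (hWp.sub hvt) (by
        simp only [Pi.sub_apply]
        rw [hvW, ← hE, ← hW]; ring) (by
        intro s hs
        have h1 := hbefore s hs
        have h2 := hv.nonneg r₀ hr0.le s hs.1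
        have := Real.rpow_lt_rpow h2 (sub_pos.mp h1) (by linarith : 0 < p)
        simp only [Pi.sub_apply]
        linarith)
    rw [hv.pde r₀ hr0 t₀ ht0, hvW] at htt
    simp only [← hE, ← hW] at htt
    -- main inequality
    have hode := hφ.ode r₀ hr0
    set cN := ((n:ℝ) - 1) / r₀ with hcN
    have hlap : -φ r₀ ^ p - g t₀ * (F2 + cN * F1 r₀) + (φ r₀ - g t₀ * ψ r₀) ^ p ≤
        p * (φ r₀ - g t₀ * ψ r₀) ^ (p - 1) * ((k * g t₀ + C * g t₀ ^ 2) * ψ r₀) := by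
      have := mul_le_mul_of_nonneg_left hFsub hg.le
      linarith
    have hlz : E * ((η * (-(-(2 * r₀) / (r₀ ^ 2) ^ 2)) + X2 r₀) +
        cN * (η * (-(r₀ ^ 2)⁻¹) + X1 r₀)) ≤ (E * (η * r₀⁻¹ + X r₀)) ^ p := by
      have e1 : η * (-(-(2 * r₀) / (r₀ ^ 2) ^ 2)) + cN * (η * (-(r₀ ^ 2)⁻¹)) =
          -(η * ((n:ℝ) - 3) * (r₀⁻¹) ^ 3) := by
        rw [hcN]; field_simp; ring
      have e2 : 0 ≤ η * ((n:ℝ) - 3) * (r₀⁻¹) ^ 3 :=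
        mul_nonneg (mul_nonneg hη.le (by linarith)) (by positivity)
      have e3 : X r₀ ^ p ≤ (η * r₀⁻¹ + X r₀) ^ p :=
        Real.rpow_le_rpow hXp.le (by have : 0 < η * r₀⁻¹ := by positivity
                                     linarith) (by linarith)
      rw [Real.mul_rpow (by linarith) (by positivity)]
      have e4 : E ≤ E ^ p := Real.self_le_rpow_of_one_le hE1 hp.le
      have e5 : 0 ≤ X r₀ ^ p := by positivity
      calc _ ≤ E * X r₀ ^ p := by
            apply mul_le_mul_of_nonneg_left _ (by linarith)
            linarith
        _ ≤ E ^ p * (η * r₀⁻¹ + X r₀) ^ p := by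
            apply mul_le_mul e4 e3 e5 (by positivity)
    have hCpos : 0 < C := by rw [hC]; positivity
    have hψp := hψ0 r₀
    have hfin := aux_add_barrier p (φ r₀ - g t₀ * ψ r₀) ((k * g t₀ + C * g t₀ ^ 2) * ψ r₀)
      (-φ r₀ ^ p - g t₀ * (F2 + cN * F1 r₀)) (E * (η * r₀⁻¹ + X r₀)) _ hp hw0 (by positivity) hz0
      hlap hlz
    rw [← hW] at hfin
    have s3 : cN * deriv (fun ρ => v ρ t₀) r₀ =
      cN * (deriv φ r₀ - g t₀ * F1 r₀ + E * (η * (-(r₀ ^ 2)⁻¹) + X1 r₀)) := by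
      congr 1; linarith
    have ee : p * W ^ (p - 1) * ((k * g t₀ + C * g t₀ ^ 2) * ψ r₀ + 2 * (E * (η * r₀⁻¹ + X r₀))) =
      ((k * g t₀ + C * g t₀ ^ 2) * ψ r₀ + 2 * (E * (η * r₀⁻¹ + X r₀))) * p * W ^ (p - 1) := by ring
    rw [ee] at hfin
    linarith

set_option maxHeartbeats 1000000 in
/-- Lemma 6.1: let `n > 10`, `p > p_c`, `α > 0`, and let `v₀` be continuous,
nonnegative, with `v₀(r) ≤ φ_α(r) − b(r+1)^{−γ}` for all `r ≥ 0`, with `b > 0` and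
`γ ∈ (ν+λ₁, (n−2)/2)`. Then there is `c > 0` such that every bounded classical radial
solution `v` with initial data `v₀` satisfies `φ_α(0) − v(0,t) ≥ c e^{−κ(γ)t}`. -/
theorem radial_lower_rate_from_below (n : ℕ) (hn : 10 < n) (p α b γ : ℝ)
    (hp : pc n < p) (hα : 0 < α) (hb : 0 < b)
    (hγ : γ ∈ Set.Ioo (nuExp p + lam1 n p) (((n : ℝ) - 2) / 2))
    (φ : ℝ → ℝ) (a : ℝ) (hφ : IsSteadyStateA n p α φ a)
    (v₀ : ℝ → ℝ) (hv₀cont : ContinuousOn v₀ (Set.Ici 0))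
    (hv₀nonneg : ∀ r ≥ (0 : ℝ), 0 ≤ v₀ r)
    (hv₀up : ∀ r ≥ (0 : ℝ), v₀ r ≤ φ r - b * (r + 1) ^ (-γ)) :
    ∃ c > 0, ∀ v : ℝ → ℝ → ℝ, IsRadialSol n p v v₀ →
      ∀ t ≥ (0 : ℝ), c * Real.exp (-(kappaOf n p γ) * t) ≤ φ 0 - v 0 t := by
  obtain ⟨hp1, hν0, hnν, hl0, hprod⟩ := aux_params n hn p hp
  obtain ⟨hL0, hLp⟩ := aux_L n p hp1 hν0 hnν
  have hn' : (11:ℝ) ≤ n := by exact_mod_cast hn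
  obtain ⟨hγ1, hγ2⟩ := hγ
  have hγ0 : 0 < γ := by linarith
  have hPL : 0 < p * Lconst n p ^ (p - 1) := by positivity
  have hkk : (kappaOf n p γ + 1) * p * Lconst n p ^ (p - 1) = γ * ((n:ℝ) - 2 - γ) := by
    rw [kappaOf, mul_assoc, sub_add_cancel, div_mul_cancel₀ _ hPL.ne']
  have hk : 0 < kappaOf n p γ := by
    rw [kappaOf, sub_pos, one_lt_div hPL, hLp, ← hprod]
    nlinarith
  set k := kappaOf n p γ
  obtain ⟨R0, hR0, hpot⟩ := aux_potential n p α a φ hφ hp1 hL0 hl0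
  have ha := hφ.a_pos
  obtain ⟨μ, hμ0, hμl, hμ2⟩ : ∃ μ : ℝ, 0 < μ ∧ μ ≤ lam1 n p ∧ 2 * γ + μ < n - 2 := by
    refine ⟨min (lam1 n p) (((n:ℝ) - 2 - 2 * γ) / 2), lt_min hl0 (by linarith),
      min_le_left _ _, ?_⟩
    have := min_le_right (lam1 n p) (((n:ℝ) - 2 - 2 * γ) / 2)
    linarith
  obtain ⟨ψ, hψc, hψ0, hψle, hψsub⟩ := aux_psi n γ μ R0 (p * (2 * a / Lconst n p))
    (fun r => (k + 1) * p * φ r ^ (p - 1)) hμ0 hγ0 hμ2 hR0 (by positivity)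
    (by
      intro r hr
      have := hφ.pos r hr.le
      positivity)
    (by
      intro r hr
      have hr1 : 1 ≤ r := le_trans hR0 hr
      have h1 := hpot r hr
      have h2 : r ^ (-lam1 n p) ≤ r ^ (-μ) :=
        Real.rpow_le_rpow_of_exponent_le hr1 (by linarith)
      rw [← hkk]
      have h3 : (k + 1) * p * (Lconst n p ^ (p - 1) * (r⁻¹ ^ 2 *
          (1 - p * (2 * a / Lconst n p) * r ^ (-lam1 n p)))) ≤ (k + 1) * p * φ r ^ (p - 1) :=
        mul_le_mul_of_nonneg_left h1 (by positivity)
      refine le_trans ?_ h3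
      rw [mul_assoc ((k + 1) * p)]
      have hC1 : 0 ≤ p * (2 * a / Lconst n p) := by positivity
      have h4 := mul_le_mul_of_nonneg_left h2 hC1
      have h5 : 0 ≤ (k + 1) * p := by positivity
      have h6 : 0 ≤ Lconst n p ^ (p - 1) := by positivity
      have h7 : 0 ≤ r⁻¹ ^ 2 := by positivity
      refine mul_le_mul_of_nonneg_left (mul_le_mul_of_nonneg_left
        (mul_le_mul_of_nonneg_left ?_ h7) h6) h5
      linarith)
  obtain ⟨K0, hK0d, hK0⟩ : ∃ K0, K0 = 2 ^ γ / b ∧ 0 < K0 := ⟨_, rfl, by positivity⟩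
  have hK0b : (2:ℝ) ^ γ = K0 * b := by rw [hK0d]; field_simp
  have hφlow : ∀ r ≥ 0, b * (r + 1) ^ (-γ) ≤ φ r := by
    intro r hr
    have h1 := hv₀nonneg r hr
    have h2 := hv₀up r hr
    linarith
  have hψφ : ∀ r ≥ 0, ψ r ≤ K0 * φ r := by
    intro r hr
    refine (hψle r hr).trans ?_
    rw [hK0b, mul_assoc]
    exact mul_le_mul_of_nonneg_left (hφlow r hr) hK0.le
  obtain ⟨g, c, hc, hgd, hg⟩ := aux_g k (2 * p * K0 * (k + 1)) (1 / (2 * p * K0)) hk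
    (by positivity) (by positivity)
  have hg1 : ∀ t ≥ 0, 2 * p * K0 * g t ≤ 1 := by
    intro t ht
    have := (hg t ht).2.1
    rw [le_div_iff₀ (by positivity)] at this
    linarith
  have hinit : ∀ r ≥ 0, v₀ r ≤ φ r - g 0 * ψ r := by
    intro r hr
    refine (hv₀up r hr).trans ?_
    have h1 := hg1 0 le_rfl
    have h0 := (hg 0 le_rfl).1
    have h2 : K0 * g 0 ≤ 1 := by
      have : 0 < K0 * g 0 := by positivity
      nlinarith
    have h3 := mul_le_mul_of_nonneg_left (hψle r hr) h0.le
    have h4 : 0 < b * (r + 1) ^ (-γ) := by positivity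
    rw [hK0b] at h3
    nlinarith
  obtain ⟨A, hA, hbar⟩ := aux_barrier n (nuExp p) p (by linarith) hp1 rfl
  refine ⟨c * ψ 0, mul_pos hc (hψ0 0), ?_⟩
  intro v hv t ht
  -- comparison for positive radius
  have hcomp : ∀ r > 0, v r t ≤ φ r - g t * ψ r := by
    intro r hr
    have hev : ∀ᶠ R : ℝ in atTop, v r t ≤ φ r - g t * ψ r +
        Real.exp (2 * t) * (R⁻¹ * r⁻¹ + A * (R / (R ^ 2 - r ^ 2)) ^ nuExp p) := by
      filter_upwards [eventually_gt_atTop r] with R hR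
      have hR0 : 0 < R := hr.trans hR
      obtain ⟨X1, X2, hX⟩ := hbar R hR0 _ rfl
      have := aux_compare n hn p α a k _ K0 R⁻¹ A R φ ψ g v₀ v hp1 hφ hv hk hK0 rfl
        (by positivity) hA hR0 hν0 hψc hψ0 hψφ hψsub hgd (fun t ht => (hg t ht).1) hg1 hinit
        _ rfl X1 X2 hX r ⟨hr, hR⟩ t ht
      have hq0 : 0 < R ^ 2 - r ^ 2 := by nlinarith
      rw [Real.div_rpow hR0.le hq0.le, div_eq_mul_inv, ← Real.rpow_neg hq0.le, ← mul_assoc A]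
      exact this
    have hlim : Tendsto (fun R : ℝ => φ r - g t * ψ r +
        Real.exp (2 * t) * (R⁻¹ * r⁻¹ + A * (R / (R ^ 2 - r ^ 2)) ^ nuExp p)) atTop
        (nhds (φ r - g t * ψ r + Real.exp (2 * t) * (0 * r⁻¹ + A * 0 ^ nuExp p))) := by
      have hquot : Tendsto (fun R : ℝ => R / (R ^ 2 - r ^ 2)) atTop (nhds 0) := by
        have h1 : Tendsto (fun R : ℝ => R - r ^ 2 / R) atTop atTop := by
          have h2 : Tendsto (fun R : ℝ => -(r ^ 2 / R)) atTop (nhds (-0)) :=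
            (tendsto_const_nhds.div_atTop tendsto_id).neg
          simpa [sub_eq_add_neg] using tendsto_id.atTop_add h2
        refine (tendsto_inv_atTop_zero.comp h1).congr' ?_
        filter_upwards [eventually_gt_atTop r] with R hR
        have hR0 : 0 < R := hr.trans hR
        have hq0 : 0 < R ^ 2 - r ^ 2 := by nlinarith
        have : R - r ^ 2 / R = (R ^ 2 - r ^ 2) / R := by field_simp
        simp only [Function.comp]
        rw [this, inv_div]
      exact (((tendsto_inv_atTop_zero.mul_const r⁻¹).add
        ((hquot.rpow_const (Or.inr hν0.le)).const_mul A)).const_mul _).const_add _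
    have := ge_of_tendsto hlim hev
    rw [Real.zero_rpow hν0.ne'] at this
    linarith
  -- pass to the origin
  have hzero : v 0 t ≤ φ 0 - g t * ψ 0 := by
    have hcv : ContinuousWithinAt (fun r => v r t) (Ioi 0) 0 := by
      have h1 : ContinuousWithinAt (fun q : ℝ × ℝ => v q.1 q.2) (Ici 0 ×ˢ Ici 0) ((0:ℝ), t) :=
        hv.cont _ ⟨mem_Ici.mpr (le_refl (0:ℝ)), ht⟩
      have h2 : ContinuousWithinAt (fun r : ℝ => ((r, t) : ℝ × ℝ)) (Ioi 0) 0 := by fun_prop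
      exact ContinuousWithinAt.comp (f := fun r : ℝ => ((r, t) : ℝ × ℝ)) h1 h2
        (fun r hr => ⟨Ioi_subset_Ici_self hr, ht⟩)
    have hcφ : ContinuousWithinAt (fun r => φ r - g t * ψ r) (Ioi 0) 0 :=
      ContinuousWithinAt.sub ((hφ.cont 0 (mem_Ici.mpr (le_refl (0:ℝ)))).mono Ioi_subset_Ici_self)
        ((hψc.const_mul (g t)).continuousWithinAt)
    refine le_of_tendsto_of_tendsto hcv hcφ ?_
    filter_upwards [self_mem_nhdsWithin] with r hr
    exact hcomp r hr
  have hgt := mul_le_mul_of_nonneg_right (hg t ht).2.2 (hψ0 0).le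
  have e : c * ψ 0 * Real.exp (-k * t) = c * Real.exp (-k * t) * ψ 0 := by ring
  rw [e]
  linarith
end
end

section
/- Let n ≥ 3 be an integer, p > 1, κ > 0 and A > 0. Let φ : (0,∞) → (0,∞) be C² with φ'' + ((n−1)/r)φ' + φ^p = 0 for all r > 0, and let f : (0,∞) → (0,∞) be C² with f'' + ((n−1)/r)f' + (κ+1)p φ^{p−1} f = 0 for all r > 0. Define w(r,t) := φ(r) + A e^{−κt} f(r). Then for all r > 0 and t > 0, ∂_t(w^p)(r,t) − w_rr(r,t) − ((n−1)/r) w_r(r,t) − w^p(r,t) ≤ 0; that is, w is a subsolution of the equation (v^p)_t = v_rr + ((n−1)/r)v_r + v^p. -/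
noncomputable section

open Real Filter Set

theorem aux_d1 {g : ℝ → ℝ} (hg : ContDiffOn ℝ 2 g (Set.Ioi 0)) {r : ℝ} (hr : 0 < r) :
    DifferentiableAt ℝ g r ∧ DifferentiableAt ℝ (deriv g) r := by
  have hmem : Set.Ioi (0 : ℝ) ∈ nhds r := Ioi_mem_nhds hr
  refine ⟨(hg.differentiableOn (by norm_num)).differentiableAt hmem, ?_⟩
  have h1 : ContDiffOn ℝ 1 (deriv g) (Set.Ioi 0) :=
    hg.deriv_of_isOpen isOpen_Ioi (by norm_num)
  exact (h1.differentiableOn (by norm_num)).differentiableAt hmem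

theorem aux_conv {a g p : ℝ} (ha : 0 < a) (hg : 0 < g) (hp : 1 < p) :
    a ^ p + p * a ^ (p - 1) * g ≤ (a + g) ^ p := by
  have h := one_add_mul_self_le_rpow_one_add (s := g / a)
    (by have := div_pos hg ha; linarith) hp.le
  have hap : 0 < a ^ p := Real.rpow_pos_of_pos ha p
  have e : a + g = a * (1 + g / a) := by field_simp
  rw [e, Real.mul_rpow ha.le (by positivity), Real.rpow_sub_one ha.ne']
  calc _ = a ^ p * (1 + p * (g / a)) := by field_simp
    _ ≤ _ := by gcongr

/-- from Lemma 5.1: if `φ` is a positive radial steady state of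
`Δv + v^p = 0` and `f` a positive solution of the linearized equation with eigenvalue
parameter `κ > 0`, then `w(r,t) = φ(r) + A e^{−κt} f(r)` satisfies
`∂_t(w^p) − w_rr − ((n−1)/r) w_r − w^p ≤ 0`, i.e. `w` is a subsolution. -/
theorem separated_perturbation_is_subsolution (n : ℕ) (hn : 3 ≤ n) (p κ A : ℝ)
    (hp : 1 < p) (hκ : 0 < κ) (hA : 0 < A)
    (φ f : ℝ → ℝ)
    (hφpos : ∀ r > (0 : ℝ), 0 < φ r) (hφsmooth : ContDiffOn ℝ 2 φ (Set.Ioi 0))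
    (hφode : ∀ r > (0 : ℝ), deriv (deriv φ) r + ((n : ℝ) - 1) / r * deriv φ r + φ r ^ p = 0)
    (hfpos : ∀ r > (0 : ℝ), 0 < f r) (hfsmooth : ContDiffOn ℝ 2 f (Set.Ioi 0))
    (hfode : ∀ r > (0 : ℝ),
      deriv (deriv f) r + ((n : ℝ) - 1) / r * deriv f r
        + (κ + 1) * p * φ r ^ (p - 1) * f r = 0) :
    ∀ r > (0 : ℝ), ∀ t > (0 : ℝ),
      deriv (fun s => (φ r + A * Real.exp (-κ * s) * f r) ^ p) t
        - deriv (deriv fun ρ => φ ρ + A * Real.exp (-κ * t) * f ρ) r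
        - ((n : ℝ) - 1) / r * deriv (fun ρ => φ ρ + A * Real.exp (-κ * t) * f ρ) r
        - (φ r + A * Real.exp (-κ * t) * f r) ^ p ≤ 0 := by
  intro r hr t ht
  set c : ℝ := A * Real.exp (-κ * t) with hc
  have hcpos : 0 < c := by positivity
  have hφr := hφpos r hr
  have hfr := hfpos r hr
  have hgpos : 0 < c * f r := by positivity
  have hd : ∀ ρ > (0 : ℝ), deriv (fun ρ => φ ρ + c * f ρ) ρ = deriv φ ρ + c * deriv f ρ := by
    intro ρ hρ
    exact ((aux_d1 hφsmooth hρ).1.hasDerivAt.add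
      ((aux_d1 hfsmooth hρ).1.hasDerivAt.const_mul c)).deriv
  have hdd : deriv (deriv fun ρ => φ ρ + c * f ρ) r
      = deriv (deriv φ) r + c * deriv (deriv f) r := by
    have he : (deriv fun ρ => φ ρ + c * f ρ) =ᶠ[nhds r] fun ρ => deriv φ ρ + c * deriv f ρ := by
      filter_upwards [Ioi_mem_nhds hr] with ρ hρ using hd ρ hρ
    rw [he.deriv_eq]
    exact ((aux_d1 hφsmooth hr).2.hasDerivAt.add
      ((aux_d1 hfsmooth hr).2.hasDerivAt.const_mul c)).deriv
  have ht' : deriv (fun s => (φ r + A * Real.exp (-κ * s) * f r) ^ p) t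
      = -κ * (c * f r) * p * (φ r + c * f r) ^ (p - 1) := by
    have h1 : HasDerivAt (fun s => φ r + A * Real.exp (-κ * s) * f r) (-κ * (c * f r)) t := by
      have h2 := ((((hasDerivAt_id t).const_mul (-κ)).exp.const_mul A).mul_const (f r)).const_add (φ r)
      refine HasDerivAt.congr_deriv h2 ?_
      rw [hc]
      simp only [id]
      ring
    exact (h1.rpow_const (p := p) (Or.inr hp.le)).deriv
  rw [ht', hdd, hd r hr]
  have hconv := aux_conv hφr hgpos hp
  have hmono : φ r ^ (p - 1) ≤ (φ r + c * f r) ^ (p - 1) :=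
    Real.rpow_le_rpow hφr.le (by linarith) (by linarith)
  have hm := mul_le_mul_of_nonneg_left hmono (show 0 ≤ κ * (c * f r) * p by positivity)
  have h1 := hφode r hr
  have h2 := congrArg (c * ·) (hfode r hr)
  simp only [mul_zero] at h2
  linarith
end
end

section
/- Let n ≥ 3 be an integer, p > 1, κ > 0 and A > 0. Let φ : (0,∞) → (0,∞) be C² with φ'' + ((n−1)/r)φ' + φ^p = 0 for all r > 0, and let f : (0,∞) → (0,∞) be C² with f'' + ((n−1)/r)f' + (κ+1)p φ^{p−1} f = 0 for all r > 0. Define w(r,t) := φ(r) − A e^{−κt} f(r). Then at every point (r,t) with r > 0, t > 0 and w(r,t) > 0, one has ∂_t(w^p)(r,t) − w_rr(r,t) − ((n−1)/r) w_r(r,t) − w^p(r,t) ≤ 0. -/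
noncomputable section

open Real Filter Set

theorem aux_diff (g : ℝ → ℝ) (hg : ContDiffOn ℝ 2 g (Set.Ioi 0)) (r : ℝ) (hr : 0 < r) :
    DifferentiableAt ℝ g r ∧ DifferentiableAt ℝ (deriv g) r := by
  constructor
  · exact (hg.differentiableOn (by norm_num)).differentiableAt (Ioi_mem_nhds hr)
  · have h : ContDiffOn ℝ 1 (deriv g) (Set.Ioi 0) :=
      hg.deriv_of_isOpen isOpen_Ioi (by norm_num)
    exact (h.differentiableOn (by norm_num)).differentiableAt (Ioi_mem_nhds hr)

theorem aux_convex (p a b : ℝ) (hp : 1 < p) (ha : 0 < a) (hb : 0 < b) :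
    a ^ p + p * a ^ (p - 1) * (b - a) ≤ b ^ p := by
  have h := one_add_mul_self_le_rpow_one_add (s := b / a - 1) (by
    have : 0 < b / a := by positivity
    linarith) hp.le
  have e : 1 + (b / a - 1) = b / a := by ring
  rw [e, Real.div_rpow hb.le ha.le, le_div_iff₀ (by positivity)] at h
  have e2 : a ^ p = a ^ (p - 1) * a := by
    rw [Real.rpow_sub_one ha.ne']; field_simp
  calc _ = (1 + p * (b / a - 1)) * a ^ p := by
        rw [e2]; field_simp
    _ ≤ _ := h

/-- from Lemma 4.1: if `φ` is a positive radial steady state of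
`Δv + v^p = 0` and `f` a positive solution of the linearized equation with eigenvalue
parameter `κ > 0`, then at every point where `w(r,t) = φ(r) − A e^{−κt} f(r)` is
positive, `∂_t(w^p) − w_rr − ((n−1)/r) w_r − w^p ≤ 0`. -/
theorem separated_negative_perturbation_inequality (n : ℕ) (hn : 3 ≤ n) (p κ A : ℝ)
    (hp : 1 < p) (hκ : 0 < κ) (hA : 0 < A)
    (φ f : ℝ → ℝ)
    (hφpos : ∀ r > (0 : ℝ), 0 < φ r) (hφsmooth : ContDiffOn ℝ 2 φ (Set.Ioi 0))
    (hφode : ∀ r > (0 : ℝ), deriv (deriv φ) r + ((n : ℝ) - 1) / r * deriv φ r + φ r ^ p = 0)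
    (hfpos : ∀ r > (0 : ℝ), 0 < f r) (hfsmooth : ContDiffOn ℝ 2 f (Set.Ioi 0))
    (hfode : ∀ r > (0 : ℝ),
      deriv (deriv f) r + ((n : ℝ) - 1) / r * deriv f r
        + (κ + 1) * p * φ r ^ (p - 1) * f r = 0) :
    ∀ r > (0 : ℝ), ∀ t > (0 : ℝ), 0 < φ r - A * Real.exp (-κ * t) * f r →
      deriv (fun s => (φ r - A * Real.exp (-κ * s) * f r) ^ p) t
        - deriv (deriv fun ρ => φ ρ - A * Real.exp (-κ * t) * f ρ) r
        - ((n : ℝ) - 1) / r * deriv (fun ρ => φ ρ - A * Real.exp (-κ * t) * f ρ) r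
        - (φ r - A * Real.exp (-κ * t) * f r) ^ p ≤ 0 := by
  intro r hr t ht hw
  have hwd : ∀ ρ > (0 : ℝ), deriv (fun ρ => φ ρ - A * Real.exp (-κ * t) * f ρ) ρ
      = deriv φ ρ - A * Real.exp (-κ * t) * deriv f ρ := fun ρ hρ =>
    ((aux_diff φ hφsmooth ρ hρ).1.hasDerivAt.sub
      ((aux_diff f hfsmooth ρ hρ).1.hasDerivAt.const_mul _)).deriv
  have hwdd : deriv (deriv fun ρ => φ ρ - A * Real.exp (-κ * t) * f ρ) r
      = deriv (deriv φ) r - A * Real.exp (-κ * t) * deriv (deriv f) r := by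
    have he : (deriv fun ρ => φ ρ - A * Real.exp (-κ * t) * f ρ) =ᶠ[nhds r]
        fun ρ => deriv φ ρ - A * Real.exp (-κ * t) * deriv f ρ := by
      filter_upwards [Ioi_mem_nhds hr] with ρ hρ using hwd ρ hρ
    rw [he.deriv_eq]
    exact ((aux_diff φ hφsmooth r hr).2.hasDerivAt.sub
      ((aux_diff f hfsmooth r hr).2.hasDerivAt.const_mul _)).deriv
  have h1 : HasDerivAt (fun s => φ r - A * Real.exp (-κ * s) * f r)
      (κ * (A * Real.exp (-κ * t) * f r)) t := by
    have h0 : HasDerivAt (fun s : ℝ => -κ * s) (-κ) t := by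
      simpa using (hasDerivAt_id t).const_mul (-κ)
    have := ((h0.exp.const_mul A).mul_const (f r)).const_sub (φ r)
    exact this.congr_deriv (by ring)
  have h2 := (h1.rpow_const (p := p) (Or.inl hw.ne')).deriv
  rw [h2, hwdd, hwd r hr]
  have hφ := hφode r hr
  have hf := hfode r hr
  have hg : 0 < A * Real.exp (-κ * t) * f r := by
    have := hfpos r hr
    positivity
  have hc := aux_convex p (φ r) _ hp (hφpos r hr) hw
  have hm : (φ r - A * Real.exp (-κ * t) * f r) ^ (p - 1) ≤ φ r ^ (p - 1) :=
    Real.rpow_le_rpow hw.le (by linarith) (by linarith)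
  have hk : 0 ≤ κ * (A * Real.exp (-κ * t) * f r) * p := by positivity
  have hm2 := mul_le_mul_of_nonneg_left hm hk
  generalize (φ r - A * Real.exp (-κ * t) * f r) ^ (p - 1) = W1 at *
  generalize (φ r - A * Real.exp (-κ * t) * f r) ^ p = W at *
  generalize Real.exp (-κ * t) = E at *
  linear_combination hm2 + hc - hφ + A * E * hf
end
end
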